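/- Fix ε ∈ [0,1) and let u : ℝ → ℝ be the unique continuous solution of Kepler's equation u(t) − ε sin u(t) = t, and set ρ(t) = 1 − ε cos u(t) (a 2π-periodic positive function). For 0 < r < 2/(1+ε) define F_ε(t,r) = (1 + rρ(t) cos t)/(r²ρ(t)² + 4(1 + rρ(t) cos t))^{3/2} + (1 − rρ(t) cos t)/(r²ρ(t)² + 4(1 − rρ(t) cos t))^{3/2}, which is 2π-periodic in t; the linearization of the curved Sitnikov problem at the equilibrium (π,0) is ẍ = F_ε(t,r)x. Then there exists a sequence r₀ ≤ r₁ < r₂ ≤ r₃ < ⋯ < r_{2n} ≤ r_{2n+1} < ⋯ with rₙ → 2/(1+ε) such that: for every n ≥ 1 and every r ∈ (r_{2n−1}, r_{2n}), the normalized fundamental solutions x₁, x₂ of ẍ − F_ε(t,r)x = 0 satisfy |x₁(2π) + x₂'(2π)| < 2 (the equilibrium (π,0) is strongly stable); and every interval (r_{2n}, r_{2n+1}) contains a value of r for which |x₁(2π) + x₂'(2π)| ≥ 2 (not strongly stable). In other words, the equilibrium (π,0) loses and regains strong linear stability infinitely many times as r increases towards 2/(1+ε). -/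

import Mathlib

/-- The coefficient of the linearization of the curved Sitnikov problem (eccentricity
`ε`, `R = 1`) at the equilibrium `(π,0)`, where `ρ(t) = 1 - ε cos u(t)` and `u` solves
Kepler's equation. -/
noncomputable def Feps (ρ : ℝ → ℝ) (t r : ℝ) : ℝ :=
  (1 + r * ρ t * Real.cos t) /
      (r ^ 2 * ρ t ^ 2 + 4 * (1 + r * ρ t * Real.cos t)) ^ ((3 : ℝ) / 2) +
    (1 - r * ρ t * Real.cos t) /
      (r ^ 2 * ρ t ^ 2 + 4 * (1 - r * ρ t * Real.cos t)) ^ ((3 : ℝ) / 2)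

/-- `x₁, x₂` (with derivatives `v₁, v₂`) are the normalized fundamental solutions of
the Hill-type equation `ẍ - b(t)x = 0`. -/
def IsFundSolOf (b x₁ v₁ x₂ v₂ : ℝ → ℝ) : Prop :=
  (∀ t, HasDerivAt x₁ (v₁ t) t) ∧ (∀ t, HasDerivAt v₁ (b t * x₁ t) t) ∧
    x₁ 0 = 1 ∧ v₁ 0 = 0 ∧
    (∀ t, HasDerivAt x₂ (v₂ t) t) ∧ (∀ t, HasDerivAt v₂ (b t * x₂ t) t) ∧
    x₂ 0 = 0 ∧ v₂ 0 = 1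

section Auxiliary

open MeasureTheory Set Filter Topology Interval

/-- The terms of the Picard series of the linear equation `z' = A p t z`, `z 0 = z₀`. -/
noncomputable def picardTerm {P E : Type*} [NormedAddCommGroup E] [NormedSpace ℝ E]
    (A : P → ℝ → E →L[ℝ] E) (z₀ : E) : ℕ → P → ℝ → E
  | 0 => fun _ _ => z₀
  | n + 1 => fun p t => ∫ s in (0 : ℝ)..t, A p s (picardTerm A z₀ n p s)

lemma norm_picardTerm_le {P E : Type*} [NormedAddCommGroup E] [NormedSpace ℝ E]
    {A : P → ℝ → E →L[ℝ] E} {p : P} {z₀ : E} {C T : ℝ}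
    (hC : ∀ t, |t| ≤ T → ‖A p t‖ ≤ C) (n : ℕ) {t : ℝ} (ht : |t| ≤ T) :
    ‖picardTerm A z₀ n p t‖ ≤ C ^ n * |t| ^ n / n.factorial * ‖z₀‖ := by
  induction n generalizing t with
  | zero => simp [picardTerm]
  | succ n ih =>
    have hC0 : 0 ≤ C := (norm_nonneg _).trans (hC t ht)
    rw [picardTerm]
    refine (intervalIntegral.norm_integral_le_integral_norm_uIoc).trans ?_
    have hle : ∀ s ∈ Ι 0 t, |s| ≤ |t| := by
      intro s hs
      rcases le_total 0 t with h | h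
      · rw [uIoc_of_le h] at hs
        rw [abs_of_nonneg h, abs_of_pos hs.1]; exact hs.2
      · rw [uIoc_of_ge h] at hs
        rw [abs_of_nonpos h, abs_of_nonpos hs.2]; linarith [hs.1]
    have hint : IntegrableOn (fun s : ℝ => C ^ (n + 1) / n.factorial * ‖z₀‖ * |s - 0| ^ n)
        (Ι 0 t) := by
      have : Continuous fun s : ℝ => C ^ (n + 1) / n.factorial * ‖z₀‖ * |s - 0| ^ n := by
        fun_prop
      exact (this.intervalIntegrable 0 t).def'
    calc ∫ s in Ι 0 t, ‖A p s (picardTerm A z₀ n p s)‖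
        ≤ ∫ s in Ι 0 t, C ^ (n + 1) / n.factorial * ‖z₀‖ * |s - 0| ^ n := by
          refine integral_mono_of_nonneg (ae_of_all _ fun _ => norm_nonneg _) hint ?_
          refine (ae_restrict_iff' measurableSet_uIoc).2 (ae_of_all _ fun s hs => ?_)
          have hsT := (hle s hs).trans ht
          calc ‖A p s (picardTerm A z₀ n p s)‖ ≤ C * (C ^ n * |s| ^ n / n.factorial * ‖z₀‖) :=
                ((A p s).le_opNorm _).trans
                  (mul_le_mul (hC s hsT) (ih hsT) (norm_nonneg _) hC0)
            _ = C ^ (n + 1) / n.factorial * ‖z₀‖ * |s - 0| ^ n := by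
                rw [sub_zero]; ring
      _ = C ^ (n + 1) * |t| ^ (n + 1) / (n + 1).factorial * ‖z₀‖ := by
          rw [integral_const_mul, integral_pow_abs_sub_uIoc, Nat.factorial_succ, sub_zero]
          push_cast
          field_simp

section LinearODE

variable {P E : Type*} [TopologicalSpace P] [NormedAddCommGroup E] [NormedSpace ℝ E]
  {A : P → ℝ → E →L[ℝ] E}

lemma continuous_picardTerm (hA : Continuous fun q : P × ℝ => A q.1 q.2) (z₀ : E) (n : ℕ) :
    Continuous fun q : P × ℝ => picardTerm A z₀ n q.1 q.2 := by
  induction n with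
  | zero => exact continuous_const
  | succ n ih =>
    refine intervalIntegral.continuous_parametric_intervalIntegral_of_continuous
      (f := fun (q : P × ℝ) s => A q.1 s (picardTerm A z₀ n q.1 s)) ?_ continuous_snd
    have h : Continuous fun x : (P × ℝ) × ℝ => (x.1.1, x.2) := by fun_prop
    exact (hA.comp h).clm_apply (ih.comp h)

/-- A linear differential equation whose coefficient depends continuously on time and on a
parameter has global solutions, which depend continuously on time and on the parameter. -/
theorem exists_continuous_solution_linear [CompleteSpace E]
    (hA : Continuous fun q : P × ℝ => A q.1 q.2) (z₀ : E) :
    ∃ z : P → ℝ → E, (Continuous fun q : P × ℝ => z q.1 q.2) ∧ (∀ p, z p 0 = z₀) ∧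
      ∀ p t, HasDerivAt (z p) (A p t (z p t)) t := by
  have hAp : ∀ p, Continuous (A p) := fun p => hA.comp (by fun_prop : Continuous fun t => (p, t))
  have hterm : ∀ p n, Continuous (picardTerm A z₀ n p) := fun p n =>
    (continuous_picardTerm hA z₀ n).comp (by fun_prop : Continuous fun t => (p, t))
  have hbound : ∀ (p : P) (T : ℝ), ∃ C : ℝ, ∀ᶠ p' in 𝓝 p, ∀ t, |t| ≤ T → ‖A p' t‖ ≤ C := by
    intro p T
    obtain ⟨C, hC⟩ := (isCompact_Icc (a := -T) (b := T)).exists_bound_of_continuousOn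
      (hAp p).continuousOn
    refine ⟨C + 1, ?_⟩
    have hopen : IsOpen {q : P × ℝ | ‖A q.1 q.2‖ < C + 1} :=
      isOpen_lt hA.norm continuous_const
    obtain ⟨U, V, hU, -, hpU, hV, hUV⟩ := generalized_tube_lemma (isCompact_singleton (x := p))
      (isCompact_Icc (a := -T) (b := T)) hopen (by
        rintro ⟨p', t⟩ ⟨rfl, ht⟩
        exact (hC t ht).trans_lt (lt_add_one C))
    filter_upwards [hU.mem_nhds (hpU rfl)] with p' hp' t ht
    exact (hUV (mk_mem_prod hp' (hV (abs_le.1 ht)))).le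
  have hsummable : ∀ C T : ℝ, Summable fun n : ℕ => C ^ n * T ^ n / n.factorial * ‖z₀‖ := by
    intro C T
    simp_rw [← mul_pow]
    exact (Real.summable_pow_div_factorial _).mul_right _
  have hle : ∀ {p : P} {C T : ℝ}, 0 ≤ T → (∀ t, |t| ≤ T → ‖A p t‖ ≤ C) → ∀ n t, |t| ≤ T →
      ‖picardTerm A z₀ n p t‖ ≤ C ^ n * T ^ n / n.factorial * ‖z₀‖ := by
    intro p C T hT hC n t ht
    have hC0 : 0 ≤ C := (norm_nonneg _).trans (hC t ht)
    refine (norm_picardTerm_le hC n ht).trans ?_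
    gcongr
  have hsum : ∀ p t, Summable fun n => picardTerm A z₀ n p t := by
    intro p t
    obtain ⟨C, hC⟩ := hbound p |t|
    exact .of_norm_bounded (hsummable C |t|)
      fun n => hle (abs_nonneg t) hC.self_of_nhds n t le_rfl
  refine ⟨fun p t => ∑' n, picardTerm A z₀ n p t, ?_, ?_, ?_⟩
  · rw [continuous_iff_continuousAt]
    rintro ⟨p, t⟩
    obtain ⟨C, hC⟩ := hbound p (|t| + 1)
    obtain ⟨U, hU, hUo, hpU⟩ := eventually_nhds_iff.1 hC
    have hS : U ×ˢ Metric.ball t 1 ∈ 𝓝 (p, t) :=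
      prod_mem_nhds (hUo.mem_nhds hpU) (Metric.ball_mem_nhds t one_pos)
    refine ContinuousOn.continuousAt (continuousOn_tsum
      (fun n => (continuous_picardTerm hA z₀ n).continuousOn) (hsummable C (|t| + 1)) ?_) hS
    rintro n ⟨p', t'⟩ ⟨hp', ht'⟩
    refine hle (by positivity) (hU p' hp') n t' ?_
    have h1 : |t' - t| < 1 := by simpa [Real.dist_eq] using ht'
    have h2 := abs_sub_abs_le_abs_sub t' t

    linarith
  · intro p
    change ∑' n, picardTerm A z₀ n p 0 = z₀
    rw [tsum_eq_single 0]
    · rfl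
    · intro n hn
      obtain ⟨m, rfl⟩ := Nat.exists_eq_succ_of_ne_zero hn
      simp [picardTerm]
  · intro p t
    obtain ⟨C, hC⟩ := hbound p (|t| + 1)
    have hC := hC.self_of_nhds
    have hder : ∀ n s, HasDerivAt (picardTerm A z₀ (n + 1) p) (A p s (picardTerm A z₀ n p s)) s :=
      fun n s => ((hAp p).clm_apply (hterm p n)).integral_hasStrictDerivAt 0 s |>.hasDerivAt
    have hmem : ∀ {s}, s ∈ Metric.ball t 1 → |s| ≤ |t| + 1 := by
      intro s hs
      have h1 : |s - t| < 1 := by simpa [Real.dist_eq] using hs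
      have h2 := abs_sub_abs_le_abs_sub s t
      linarith
    have hC0 : 0 ≤ C := (norm_nonneg _).trans (hC t (by linarith))
    have key : HasDerivAt (fun s => ∑' n, picardTerm A z₀ (n + 1) p s)
        (∑' n, A p t (picardTerm A z₀ n p t)) t := by
      refine hasDerivAt_tsum_of_isPreconnected ((hsummable C (|t| + 1)).mul_left C)
        Metric.isOpen_ball (convex_ball t 1).isPreconnected (fun n s _ => hder n s)
        (fun n s hs => ?_) (Metric.mem_ball_self one_pos)
        ((summable_nat_add_iff 1).2 (hsum p t)) (Metric.mem_ball_self one_pos)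
      exact ((A p s).le_opNorm _).trans (mul_le_mul (hC s (hmem hs))
        (hle (by positivity) hC n s (hmem hs)) (norm_nonneg _) hC0)
    rw [← ContinuousLinearMap.map_tsum _ (hsum p t)] at key
    have heq : (fun s => ∑' n, picardTerm A z₀ n p s) =
        fun s => z₀ + ∑' n, picardTerm A z₀ (n + 1) p s :=
      funext fun s => (hsum p s).tsum_eq_zero_add
    change HasDerivAt (fun s => ∑' n, picardTerm A z₀ n p s) _ t
    rw [heq]
    exact key.const_add z₀

end LinearODE

section Hill

/-- The pair `(x, v)` solves the first order system of the Hill-type equation `ẍ = b(t) x`. -/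
def SolvesHill (b x v : ℝ → ℝ) : Prop :=
  (∀ t, HasDerivAt x (v t) t) ∧ ∀ t, HasDerivAt v (b t * x t) t

lemma exists_continuous_solvesHill {P : Type*} [TopologicalSpace P] {b : P → ℝ → ℝ}
    (hb : Continuous fun q : P × ℝ => b q.1 q.2) (x₀ v₀ : ℝ) :
    ∃ x v : P → ℝ → ℝ, (Continuous fun q : P × ℝ => x q.1 q.2) ∧
      (Continuous fun q : P × ℝ => v q.1 q.2) ∧
      ∀ p, x p 0 = x₀ ∧ v p 0 = v₀ ∧ SolvesHill (b p) (x p) (v p) := by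
  let A : P → ℝ → (ℝ × ℝ) →L[ℝ] ℝ × ℝ := fun p t =>
    (ContinuousLinearMap.inl ℝ ℝ ℝ).comp (ContinuousLinearMap.snd ℝ ℝ ℝ) +
      b p t • (ContinuousLinearMap.inr ℝ ℝ ℝ).comp (ContinuousLinearMap.fst ℝ ℝ ℝ)
  have hA : Continuous fun q : P × ℝ => A q.1 q.2 :=
    continuous_const.add (hb.smul continuous_const)
  obtain ⟨z, hz, hz0, hzd⟩ := exists_continuous_solution_linear hA (x₀, v₀)
  refine ⟨fun p t => (z p t).1, fun p t => (z p t).2, hz.fst, hz.snd, fun p => ?_⟩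
  refine ⟨by simp [hz0], by simp [hz0], fun t => ?_, fun t => ?_⟩
  · simpa [A] using! (ContinuousLinearMap.fst ℝ ℝ ℝ).hasFDerivAt.comp_hasDerivAt t (hzd p t)
  · simpa [A] using! (ContinuousLinearMap.snd ℝ ℝ ℝ).hasFDerivAt.comp_hasDerivAt t (hzd p t)

lemma SolvesHill.wronskian_eq {b x v y w : ℝ → ℝ} (h : SolvesHill b x v) (h' : SolvesHill b y w)
    (s t : ℝ) : x s * w s - v s * y s = x t * w t - v t * y t := by
  have hd : ∀ t, HasDerivAt (fun t => x t * w t - v t * y t) 0 t := fun t => by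
    have := ((h.1 t).mul (h'.2 t)).sub ((h.2 t).mul (h'.1 t))
    convert! this using 1
    ring
  exact is_const_of_deriv_eq_zero (fun t => (hd t).differentiableAt) (fun t => (hd t).deriv) s t

lemma SolvesHill.reflect {b x v : ℝ → ℝ} (h : SolvesHill b x v) {c : ℝ}
    (hb : ∀ t, b (c - t) = b t) : SolvesHill b (fun t => x (c - t)) (fun t => -v (c - t)) := by
  constructor
  · intro t
    simpa using (h.1 (c - t)).comp_const_sub c t
  · intro t
    simpa [hb] using ((h.2 (c - t)).comp_const_sub c t).fun_neg

variable {b x₁ v₁ x₂ v₂ : ℝ → ℝ}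

lemma IsFundSolOf.solvesHill_left (h : IsFundSolOf b x₁ v₁ x₂ v₂) : SolvesHill b x₁ v₁ :=
  ⟨h.1, h.2.1⟩

lemma IsFundSolOf.solvesHill_right (h : IsFundSolOf b x₁ v₁ x₂ v₂) : SolvesHill b x₂ v₂ :=
  ⟨h.2.2.2.2.1, h.2.2.2.2.2.1⟩

lemma IsFundSolOf.wronskian (h : IsFundSolOf b x₁ v₁ x₂ v₂) (t : ℝ) :
    x₁ t * v₂ t - v₁ t * x₂ t = 1 := by
  rw [h.solvesHill_left.wronskian_eq h.solvesHill_right t 0]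
  obtain ⟨-, -, h1, h2, -, -, h3, h4⟩ := h
  simp [h1, h2, h3, h4]

lemma IsFundSolOf.eq_of_solvesHill (h : IsFundSolOf b x₁ v₁ x₂ v₂) {x v : ℝ → ℝ}
    (hx : SolvesHill b x v) (t : ℝ) :
    x t = x 0 * x₁ t + v 0 * x₂ t ∧ v t = x 0 * v₁ t + v 0 * v₂ t := by
  have hw := h.wronskian t
  have ha := hx.wronskian_eq h.solvesHill_left t 0
  have hb := hx.wronskian_eq h.solvesHill_right t 0
  obtain ⟨-, -, h1, h2, -, -, h3, h4⟩ := h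
  rw [h1, h2] at ha
  rw [h3, h4] at hb
  constructor
  · linear_combination (-x t) * hw + x₁ t * hb - x₂ t * ha
  · linear_combination (-v t) * hw + v₁ t * hb - v₂ t * ha

lemma IsFundSolOf.trace_unique (h : IsFundSolOf b x₁ v₁ x₂ v₂) {y₁ w₁ y₂ w₂ : ℝ → ℝ}
    (h' : IsFundSolOf b y₁ w₁ y₂ w₂) (t : ℝ) : y₁ t + w₂ t = x₁ t + v₂ t := by
  have e₁ := (h.eq_of_solvesHill h'.solvesHill_left t).1
  have e₂ := (h.eq_of_solvesHill h'.solvesHill_right t).2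
  obtain ⟨-, -, h1, h2, -, -, h3, h4⟩ := h'
  rw [e₁, e₂, h1, h2, h3, h4]
  ring

/-- For a coefficient symmetric about `c`, the trace of the monodromy over `[0, 2c]` is
determined by the fundamental matrix at `c`. -/
lemma IsFundSolOf.trace_eq_of_symmetric (h : IsFundSolOf b x₁ v₁ x₂ v₂) {c : ℝ}
    (hb : ∀ t, b (2 * c - t) = b t) :
    x₁ (2 * c) + v₂ (2 * c) = 2 * (x₁ c * v₂ c + v₁ c * x₂ c) := by
  have e₁ := (h.solvesHill_left.reflect hb).wronskian_eq h.solvesHill_right 0 c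
  have e₂ := h.solvesHill_left.wronskian_eq (h.solvesHill_right.reflect hb) 0 c
  obtain ⟨-, -, h1, h2, -, -, h3, h4⟩ := h
  have hc : 2 * c - c = c := by ring
  simp only [h1, h2, h3, h4, hc, sub_zero] at e₁ e₂
  linear_combination e₁ - e₂

end Hill

section Oscillation

lemma eq_mul_cexp_integral {z q : ℝ → ℂ} (hq : Continuous q)
    (hz : ∀ t, HasDerivAt z (q t * z t) t) (t : ℝ) :
    z t = z 0 * Complex.exp (∫ s in (0 : ℝ)..t, q s) := by
  have hd : ∀ t, HasDerivAt (fun t => z t * Complex.exp (-∫ s in (0 : ℝ)..t, q s)) 0 t := by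
    intro t
    have h1 := (hq.integral_hasStrictDerivAt 0 t).hasDerivAt
    convert! (hz t).mul h1.neg.cexp using 1
    ring
  have := is_const_of_deriv_eq_zero (fun t => (hd t).differentiableAt)
    (fun t => (hd t).deriv) t 0
  simp only [intervalIntegral.integral_same, neg_zero, Complex.exp_zero, mul_one] at this
  rw [← this, mul_assoc, ← Complex.exp_add]
  simp

variable {P : Type*} [TopologicalSpace P] [PreconnectedSpace P] {b x v : P → ℝ → ℝ}
  {κ : P → ℝ} {C T x₀ v₀ : ℝ}

/-- If a Hill-type equation depending on a parameter has arbitrarily fast rotating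
solutions, then a given solution vanishes at the final time for some parameter. The function `κ`
is the weight of the Prüfer angle. -/
theorem exists_eq_zero_of_rotation [Nonempty P] (hb : Continuous fun q : P × ℝ => b q.1 q.2)
    (hx : Continuous fun q : P × ℝ => x q.1 q.2) (hv : Continuous fun q : P × ℝ => v q.1 q.2)
    (hsol : ∀ p, SolvesHill (b p) (x p) (v p)) (hx₀ : ∀ p, x p 0 = x₀) (hv₀ : ∀ p, v p 0 = v₀)
    (hne : ∀ p t, x p t ≠ 0 ∨ v p t ≠ 0)
    (h₀ : x₀ = 0 ∨ v₀ = 0) (hκ : Continuous κ) (hκ₁ : ∀ p, 1 ≤ κ p) (hC : 0 ≤ C)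
    (hbC : ∀ p t, b p t ≤ C)
    (hrot : ∀ N : ℝ, ∃ p, ∃ η ∈ Icc 0 T, N ≤ κ p * η ∧ ∀ t ∈ Icc (T - η) T, b p t ≤ -κ p ^ 2) :
    ∃ p, x p T = 0 := by
  have hκ0 : ∀ p, 0 < κ p := fun p => one_pos.trans_le (hκ₁ p)
  have hD : ∀ p t, 0 < κ p ^ 2 * x p t ^ 2 + v p t ^ 2 := by
    intro p t
    have := hκ0 p
    rcases hne p t with h | h <;> positivity
  let z : P → ℝ → ℂ := fun p t => ⟨κ p * x p t, v p t⟩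
  let q : P → ℝ → ℂ := fun p t => ⟨κ p * v p t, b p t * x p t⟩ / z p t
  have hz : ∀ p t, z p t ≠ 0 := by
    intro p t h
    have h1 := congrArg Complex.re h
    have h2 := congrArg Complex.im h
    simp only [z, Complex.zero_re, Complex.zero_im] at h1 h2
    have := hD p t
    rw [h2, ← mul_pow, h1] at this
    simp at this
  have hmk : ∀ {f g : P × ℝ → ℝ}, Continuous f → Continuous g →
      Continuous fun r => (⟨f r, g r⟩ : ℂ) := fun hf hg =>
    Complex.equivRealProdCLM.symm.continuous.comp (hf.prodMk hg)
  have hκ' : Continuous fun r : P × ℝ => κ r.1 := hκ.comp continuous_fst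
  have hqc : Continuous fun r : P × ℝ => q r.1 r.2 :=
    (hmk (hκ'.mul hv) (hb.mul hx)).div (hmk (hκ'.mul hx) hv) fun r => hz r.1 r.2
  have hqp : ∀ p, Continuous (q p) := fun p =>
    hqc.comp (by fun_prop : Continuous fun t => (p, t))
  have hzd : ∀ p t, HasDerivAt (z p) (q p t * z p t) t := by
    intro p t
    have h1 := ((hsol p).1 t).const_mul (κ p)
    have h2 := (hsol p).2 t
    have h3 := (h1.ofReal_comp).add ((h2.ofReal_comp).mul_const Complex.I)
    convert! h3 using 1
    · ext s
      simp [z, Complex.mk_eq_add_mul_I]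
    · simp only [q]
      rw [div_mul_cancel₀ _ (hz p t), Complex.mk_eq_add_mul_I]
  have hqim : ∀ p t, (q p t).im =
      κ p * (b p t * x p t ^ 2 - v p t ^ 2) / (κ p ^ 2 * x p t ^ 2 + v p t ^ 2) := by
    intro p t
    simp only [q, z, Complex.div_im, Complex.normSq_mk]
    rw [show κ p * x p t * (κ p * x p t) + v p t * v p t = κ p ^ 2 * x p t ^ 2 + v p t ^ 2 by ring]
    ring
  let θ : P → ℝ := fun p => ∫ t in (0 : ℝ)..T, (q p t).im
  have hqimc : Continuous fun r : P × ℝ => (q r.1 r.2).im := Complex.continuous_im.comp hqc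
  have hθc : Continuous θ :=
    intervalIntegral.continuous_parametric_intervalIntegral_of_continuous hqimc continuous_const
  have hpolar : ∀ p, z p T = z p 0 * Complex.exp (∫ s in (0 : ℝ)..T, q p s) := fun p =>
    eq_mul_cexp_integral (hqp p) (hzd p) T
  have him : ∀ p, (∫ s in (0 : ℝ)..T, q p s).im = θ p := fun p =>
    (Complex.imCLM.intervalIntegral_comp_comm ((hqp p).intervalIntegrable 0 T)).symm
  have hbound : ∀ p, ∀ η ∈ Icc 0 T, (∀ t ∈ Icc (T - η) T, b p t ≤ -κ p ^ 2) →
      θ p ≤ C * T - κ p * η := by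
    intro p η hη hw
    have hint : ∀ a b, IntervalIntegrable (fun t => (q p t).im) volume a b := fun a b =>
      (Complex.continuous_im.comp (hqp p)).intervalIntegrable a b
    have h1 : ∫ t in (0 : ℝ)..(T - η), (q p t).im ≤ ∫ _ in (0 : ℝ)..(T - η), C := by
      refine intervalIntegral.integral_mono_on (by linarith [hη.2]) (hint _ _) (by simp) ?_
      intro t _
      rw [hqim, div_le_iff₀ (hD p t)]
      have h2 : κ p * (b p t * x p t ^ 2) ≤ κ p * (C * x p t ^ 2) := by
        have := hκ0 p; have := hbC p t; gcongr
      have h3 : κ p * (C * x p t ^ 2) ≤ κ p ^ 2 * (C * x p t ^ 2) := by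
        have := hκ₁ p
        exact mul_le_mul_of_nonneg_right (by nlinarith) (by positivity)
      nlinarith [mul_nonneg hC (sq_nonneg (v p t)), mul_nonneg (hκ0 p).le (sq_nonneg (v p t))]
    have h2 : ∫ t in (T - η)..T, (q p t).im ≤ ∫ _ in (T - η)..T, -κ p := by
      refine intervalIntegral.integral_mono_on (by linarith [hη.1]) (hint _ _) (by simp) ?_
      intro t ht
      rw [hqim, div_le_iff₀ (hD p t)]
      have h2 : b p t * x p t ^ 2 ≤ -κ p ^ 2 * x p t ^ 2 :=
        mul_le_mul_of_nonneg_right (hw t ht) (sq_nonneg _)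
      have := mul_le_mul_of_nonneg_left h2 (hκ0 p).le
      linarith
    have h3 := intervalIntegral.integral_add_adjacent_intervals (hint 0 (T - η)) (hint (T - η) T)
    simp only [intervalIntegral.integral_const, smul_eq_mul] at h1 h2
    change ∫ t in (0 : ℝ)..T, (q p t).im ≤ _
    nlinarith [mul_nonneg hC hη.1]
  -- the Prüfer angle takes all values below some bound
  have hrange : ∀ y ≤ θ (Classical.arbitrary P), ∃ p, θ p = y := by
    intro y hy
    obtain ⟨p, η, hη, hN, hw⟩ := hrot (C * T - y)
    exact mem_range_of_exists_le_of_exists_ge hθc ⟨p, by linarith [hbound p η hη hw]⟩ ⟨_, hy⟩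
  have hre : ∀ p, κ p * x p T = Real.exp (∫ s in (0 : ℝ)..T, q p s).re *
      (κ p * x₀ * Real.cos (θ p) - v₀ * Real.sin (θ p)) := by
    intro p
    have := congrArg Complex.re (hpolar p)
    simp only [z, Complex.mul_re, Complex.exp_re, Complex.exp_im, him, hx₀, hv₀] at this
    rw [this]
    ring
  obtain ⟨n, hn⟩ := exists_nat_gt ((-θ (Classical.arbitrary P) + Real.pi) / Real.pi)
  rw [div_lt_iff₀ Real.pi_pos] at hn
  have hx0 : ∀ p, κ p * x₀ * Real.cos (θ p) - v₀ * Real.sin (θ p) = 0 → x p T = 0 := by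
    intro p hp
    have := hre p
    rw [hp, mul_zero] at this
    exact (mul_eq_zero.1 this).resolve_left (hκ0 p).ne'
  rcases h₀ with h | h
  · obtain ⟨p, hp⟩ := hrange (-(n * Real.pi)) (by linarith [Real.pi_pos])
    refine ⟨p, hx0 p ?_⟩
    simp [h, hp, Real.sin_nat_mul_pi]
  · obtain ⟨p, hp⟩ := hrange (Real.pi / 2 - n * Real.pi) (by linarith [Real.pi_pos])
    refine ⟨p, hx0 p ?_⟩
    rw [hp, Real.cos_sub_nat_mul_pi]
    simp [h]

end Oscillation

/-- A symmetric Hill-type equation depending on a parameter, with arbitrarily fast rotating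
solutions, has monodromy matrices of trace `2` and of trace `0`. -/
theorem exists_trace_eq_two_and_zero {P : Type*} [TopologicalSpace P] [PreconnectedSpace P]
    [Nonempty P] {b : P → ℝ → ℝ} {κ : P → ℝ} {C T : ℝ}
    (hb : Continuous fun q : P × ℝ => b q.1 q.2) (hsymm : ∀ p t, b p (2 * T - t) = b p t)
    (hκ : Continuous κ) (hκ₁ : ∀ p, 1 ≤ κ p) (hC : 0 ≤ C) (hbC : ∀ p t, b p t ≤ C)
    (hrot : ∀ N : ℝ, ∃ p, ∃ η ∈ Icc 0 T, N ≤ κ p * η ∧ ∀ t ∈ Icc (T - η) T, b p t ≤ -κ p ^ 2) :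
    ∃ x₁ v₁ x₂ v₂ : P → ℝ → ℝ, (∀ p, IsFundSolOf (b p) (x₁ p) (v₁ p) (x₂ p) (v₂ p)) ∧
      Continuous (fun p => x₁ p (2 * T) + v₂ p (2 * T)) ∧
      (∃ p, x₁ p (2 * T) + v₂ p (2 * T) = 2) ∧ ∃ p, x₁ p (2 * T) + v₂ p (2 * T) = 0 := by
  obtain ⟨x₁, v₁, hx₁, hv₁, h₁⟩ := exists_continuous_solvesHill hb 1 0
  obtain ⟨x₂, v₂, hx₂, hv₂, h₂⟩ := exists_continuous_solvesHill hb 0 1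
  have hfund : ∀ p, IsFundSolOf (b p) (x₁ p) (v₁ p) (x₂ p) (v₂ p) := fun p =>
    ⟨(h₁ p).2.2.1, (h₁ p).2.2.2, (h₁ p).1, (h₁ p).2.1,
      (h₂ p).2.2.1, (h₂ p).2.2.2, (h₂ p).1, (h₂ p).2.1⟩
  have hcont : Continuous fun p => x₁ p (2 * T) + v₂ p (2 * T) :=
    (hx₁.comp (by fun_prop : Continuous fun p : P => (p, 2 * T))).add
      (hv₂.comp (by fun_prop : Continuous fun p : P => (p, 2 * T)))
  have hne₁ : ∀ p t, x₁ p t ≠ 0 ∨ v₁ p t ≠ 0 := by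
    intro p t
    by_contra! h
    simpa [h.1, h.2] using (hfund p).wronskian t
  have hne₂ : ∀ p t, x₂ p t ≠ 0 ∨ v₂ p t ≠ 0 := by
    intro p t
    by_contra! h
    simpa [h.1, h.2] using (hfund p).wronskian t
  obtain ⟨p, hp⟩ := exists_eq_zero_of_rotation hb hx₁ hv₁ (fun p => (h₁ p).2.2)
    (fun p => (h₁ p).1) (fun p => (h₁ p).2.1) hne₁ (.inr rfl) hκ hκ₁ hC hbC hrot
  obtain ⟨p', hp'⟩ := exists_eq_zero_of_rotation hb hx₂ hv₂ (fun p => (h₂ p).2.2)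
    (fun p => (h₂ p).1) (fun p => (h₂ p).2.1) hne₂ (.inl rfl) hκ hκ₁ hC hbC hrot
  have htr : x₁ p (2 * T) + v₂ p (2 * T) = -2 := by
    have hw := (hfund p).wronskian T
    rw [(hfund p).trace_eq_of_symmetric (hsymm p)]
    rw [hp] at hw ⊢
    linear_combination -2 * hw
  have htr' : x₁ p' (2 * T) + v₂ p' (2 * T) = 2 := by
    have hw := (hfund p').wronskian T
    rw [(hfund p').trace_eq_of_symmetric (hsymm p')]
    rw [hp'] at hw ⊢
    linear_combination 2 * hw
  refine ⟨x₁, v₁, x₂, v₂, hfund, hcont, ⟨p', htr'⟩, ?_⟩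
  exact mem_range_of_exists_le_of_exists_ge hcont ⟨p, by rw [htr]; norm_num⟩
    ⟨p', by rw [htr']; norm_num⟩

section Kepler

variable {ε : ℝ} {u : ℝ → ℝ}

lemma kepler_injective (hε : ε ∈ Ico (0 : ℝ) 1) :
    Function.Injective fun x : ℝ => x - ε * Real.sin x := by
  intro x y h
  have h1 : x - y = ε * (Real.sin x - Real.sin y) := by
    have : x - ε * Real.sin x = y - ε * Real.sin y := h
    linear_combination this
  have h2 : |x - y| ≤ ε * |x - y| := by
    conv_lhs => rw [h1, abs_mul, abs_of_nonneg hε.1]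
    exact mul_le_mul_of_nonneg_left (Real.abs_sin_sub_sin_le x y) hε.1
  have h3 : |x - y| ≤ 0 := by nlinarith [hε.2, abs_nonneg (x - y)]
  exact sub_eq_zero.1 (abs_nonpos_iff.1 h3)

lemma kepler_reflect (hε : ε ∈ Ico (0 : ℝ) 1) (hu : ∀ t, u t - ε * Real.sin (u t) = t) (t : ℝ) :
    u (2 * Real.pi - t) = 2 * Real.pi - u t := by
  apply kepler_injective hε
  change u (2 * Real.pi - t) - ε * Real.sin (u (2 * Real.pi - t)) =
    2 * Real.pi - u t - ε * Real.sin (2 * Real.pi - u t)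
  rw [hu, Real.sin_two_pi_sub]
  linear_combination hu t

lemma kepler_abs_sub_pi_le (hε : ε ∈ Ico (0 : ℝ) 1) (hu : ∀ t, u t - ε * Real.sin (u t) = t)
    (t : ℝ) : (1 - ε) * |u t - Real.pi| ≤ |t - Real.pi| := by
  have h1 : u t - Real.pi = (t - Real.pi) - ε * Real.sin (u t - Real.pi) := by
    rw [Real.sin_sub_pi]
    linear_combination hu t
  have h2 : |u t - Real.pi| ≤ |t - Real.pi| + ε * |u t - Real.pi| := by
    calc |u t - Real.pi| = |(t - Real.pi) - ε * Real.sin (u t - Real.pi)| := by rw [← h1]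
      _ ≤ |t - Real.pi| + |ε * Real.sin (u t - Real.pi)| := abs_sub _ _
      _ ≤ |t - Real.pi| + ε * |u t - Real.pi| := by
          rw [abs_mul, abs_of_nonneg hε.1]
          have := hε.1
          exact add_le_add_right (mul_le_mul_of_nonneg_left Real.abs_sin_le_abs this) _
  linarith

end Kepler

section Coefficient

lemma rpow_three_halves {D : ℝ} (hD : 0 ≤ D) : D ^ ((3 : ℝ) / 2) = √D ^ 3 := by
  rw [Real.sqrt_eq_rpow, ← Real.rpow_natCast, ← Real.rpow_mul hD]
  norm_num

lemma div_rpow_three_halves_le {a m : ℝ} (hm : 0 < m) (hD : 0 < m ^ 2 + 4 * a) :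
    a / (m ^ 2 + 4 * a) ^ ((3 : ℝ) / 2) ≤ 1 / (4 * m) := by
  rcases le_or_gt a 0 with ha | ha
  · exact (div_nonpos_of_nonpos_of_nonneg ha (by positivity)).trans (by positivity)
  · rw [div_le_div_iff₀ (by positivity) (by positivity), rpow_three_halves hD.le]
    have h1 : m ≤ √(m ^ 2 + 4 * a) := Real.le_sqrt_of_sq_le (by linarith)
    have h2 : √(m ^ 2 + 4 * a) ^ 2 = m ^ 2 + 4 * a := Real.sq_sqrt hD.le
    calc a * (4 * m) ≤ (m ^ 2 + 4 * a) * m := by nlinarith [pow_pos hm 3]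
      _ ≤ (m ^ 2 + 4 * a) * √(m ^ 2 + 4 * a) := by gcongr
      _ = 1 * √(m ^ 2 + 4 * a) ^ 3 := by linear_combination (-√(m ^ 2 + 4 * a)) * h2

lemma div_rpow_three_halves_le_neg {a D δ : ℝ} (hδ : 0 < δ) (ha : a ≤ -1 / 2) (hD : 0 < D)
    (hDδ : D ≤ 9 * δ ^ 2) : a / D ^ ((3 : ℝ) / 2) ≤ -(1 / (54 * δ ^ 3)) := by
  have h1 : √D ≤ 3 * δ := Real.sqrt_le_iff.2 ⟨by positivity, by nlinarith⟩
  have h2 : 0 < √D := Real.sqrt_pos.2 hD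
  have h3 : √D ^ 3 ≤ 27 * δ ^ 3 := by
    calc √D ^ 3 ≤ (3 * δ) ^ 3 := by gcongr
      _ = 27 * δ ^ 3 := by ring
  rw [rpow_three_halves hD.le, neg_eq_neg_one_mul, mul_one_div,
    div_le_div_iff₀ (by positivity) (by positivity)]
  nlinarith [pow_pos hδ 3]

lemma sq_add_four_mul_pos {m t : ℝ} (hm : m ∈ Ioo (0 : ℝ) 2) :
    0 < m ^ 2 + 4 * (1 + m * Real.cos t) ∧ 0 < m ^ 2 + 4 * (1 - m * Real.cos t) := by
  have h1 : 0 < (2 - m) ^ 2 := by have := hm.2; exact pow_pos (by linarith) 2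
  have h2 : 0 ≤ m * (1 + Real.cos t) := mul_nonneg hm.1.le (by linarith [Real.neg_one_le_cos t])
  have h3 : 0 ≤ m * (1 - Real.cos t) := mul_nonneg hm.1.le (by linarith [Real.cos_le_one t])
  constructor <;> nlinarith

variable {ρ : ℝ → ℝ} {r : ℝ}

lemma Feps_eq (t : ℝ) : Feps ρ t r =
    (1 + r * ρ t * Real.cos t) / ((r * ρ t) ^ 2 + 4 * (1 + r * ρ t * Real.cos t)) ^ ((3 : ℝ) / 2) +
    (1 - r * ρ t * Real.cos t) /
      ((r * ρ t) ^ 2 + 4 * (1 - r * ρ t * Real.cos t)) ^ ((3 : ℝ) / 2) := by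
  rw [Feps, mul_pow]

lemma Feps_le {t : ℝ} (hm : r * ρ t ∈ Ioo (0 : ℝ) 2) : Feps ρ t r ≤ 1 / (2 * (r * ρ t)) := by
  obtain ⟨h1, h2⟩ := sq_add_four_mul_pos (t := t) hm
  have h3 := div_rpow_three_halves_le hm.1 h1
  have h4 := div_rpow_three_halves_le hm.1 h2
  rw [Feps_eq]
  refine (add_le_add h3 h4).trans_eq ?_
  have := hm.1.ne'
  field_simp
  norm_num

/-- Near a collision the coefficient is very negative. -/
lemma Feps_le_neg {t δ : ℝ} (hδ : 0 < δ) (hδ' : δ ≤ 1 / 8) (hm : r * ρ t < 2)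
    (hm' : 2 - 2 * δ ≤ r * ρ t) (ht : |t - Real.pi| ≤ δ) :
    Feps ρ t r ≤ -(1 / (54 * δ ^ 3)) + 1 := by
  have hm₁ : 1 ≤ r * ρ t := by linarith
  obtain ⟨h1, h2⟩ := sq_add_four_mul_pos (t := t) (m := r * ρ t) ⟨by linarith, hm⟩
  have hcos : 1 + Real.cos t ≤ δ ^ 2 / 2 := by
    have h3 := Real.one_sub_sq_div_two_le_cos (x := t - Real.pi)
    rw [Real.cos_sub_pi] at h3
    have h4 : (t - Real.pi) ^ 2 ≤ δ ^ 2 := sq_le_sq' (abs_le.1 ht).1 (abs_le.1 ht).2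
    linarith
  have hcos' : 0 ≤ 1 + Real.cos t := by linarith [Real.neg_one_le_cos t]
  have h5 : r * ρ t * (1 + Real.cos t) ≤ 2 * (δ ^ 2 / 2) := by gcongr
  have h6 : (2 - r * ρ t) ^ 2 ≤ (2 * δ) ^ 2 := by
    have : 0 ≤ 2 - r * ρ t := by linarith
    gcongr
    linarith
  rw [Feps_eq]
  refine add_le_add (div_rpow_three_halves_le_neg hδ (by nlinarith) h1 (by nlinarith)) ?_
  refine (div_rpow_three_halves_le (by linarith) h2).trans ?_
  rw [div_le_one (by linarith)]
  linarith

end Coefficient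

section Sitnikov

variable {ε : ℝ} {u ρ : ℝ → ℝ}

lemma exists_stable_and_unstable (hε : ε ∈ Ico (0 : ℝ) 1) (hu : Continuous u)
    (hKepler : ∀ t, u t - ε * Real.sin (u t) = t) (hρ : ∀ t, ρ t = 1 - ε * Real.cos (u t))
    {a : ℝ} (ha : a < 2 / (1 + ε)) :
    (∃ l h, a < l ∧ l < h ∧ h < 2 / (1 + ε) ∧ ∀ r, l < r → r < h →
      ∀ x₁ v₁ x₂ v₂ : ℝ → ℝ, IsFundSolOf (fun t => Feps ρ t r) x₁ v₁ x₂ v₂ →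
        |x₁ (2 * Real.pi) + v₂ (2 * Real.pi)| < 2) ∧
    ∃ r, a < r ∧ r < 2 / (1 + ε) ∧
      ∃ x₁ v₁ x₂ v₂ : ℝ → ℝ, IsFundSolOf (fun t => Feps ρ t r) x₁ v₁ x₂ v₂ ∧
        2 ≤ |x₁ (2 * Real.pi) + v₂ (2 * Real.pi)| := by
  obtain ⟨hε0, hε1⟩ := hε
  have hε2 : 0 < 1 + ε := by linarith
  have hε3 : 0 < 1 - ε := by linarith
  -- restrict to the parameters for which the gap `2 - r * (1 + ε)` is at most `1 / 5`
  let a' := max a ((9 / 5) / (1 + ε))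
  have ha' : a' < 2 / (1 + ε) := max_lt ha (by gcongr; norm_num)
  let P := Ioo a' (2 / (1 + ε))
  have : PreconnectedSpace P := Subtype.preconnectedSpace isPreconnected_Ioo
  have : Nonempty P := (nonempty_Ioo.2 ha').to_subtype
  have hgap : ∀ r : P, 0 < 2 - r.1 * (1 + ε) ∧ 2 - r.1 * (1 + ε) ≤ 1 / 5 := by
    rintro ⟨r, hr₁, hr₂⟩
    have h1 := (le_max_right a ((9 / 5) / (1 + ε))).trans hr₁.le
    rw [div_le_iff₀ hε2] at h1
    rw [lt_div_iff₀ hε2] at hr₂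
    constructor <;> dsimp only <;> linarith
  have hr : ∀ r : P, r.1 ∈ Icc (1 / 2 : ℝ) 2 := by
    intro r
    obtain ⟨h1, h2⟩ := hgap r
    have h3 : 0 < r.1 := by
      by_contra! h
      nlinarith
    constructor <;> nlinarith
  have hρ₁ : ∀ t, 1 - ε ≤ ρ t := fun t => by
    rw [hρ]; nlinarith [Real.cos_le_one (u t)]
  have hρ₂ : ∀ t, ρ t ≤ 1 + ε := fun t => by
    rw [hρ]; nlinarith [Real.neg_one_le_cos (u t)]
  have hρc : Continuous ρ := by
    rw [show ρ = fun t => 1 - ε * Real.cos (u t) from funext hρ]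
    fun_prop
  have hm : ∀ (r : P) t, r.1 * ρ t ∈ Ioo (0 : ℝ) 2 := by
    intro r t
    have h1 := (hr r).1
    have h2 := hρ₁ t
    refine ⟨mul_pos (by linarith) (by linarith), ?_⟩
    have h3 := mul_le_mul_of_nonneg_left (hρ₂ t) (by linarith : 0 ≤ r.1)
    linarith [(hgap r).1]
  have hb : Continuous fun q : P × ℝ => Feps ρ q.2 q.1 := by
    have hrc : Continuous fun q : P × ℝ => (q.1 : ℝ) := continuous_subtype_val.comp continuous_fst
    have hρc' : Continuous fun q : P × ℝ => ρ q.2 := hρc.comp continuous_snd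
    simp_rw [Feps_eq]
    refine .add (.div (by fun_prop) (.rpow_const (by fun_prop) ?_) ?_)
      (.div (by fun_prop) (.rpow_const (by fun_prop) ?_) ?_) <;> intro q
    · exact .inr (by norm_num)
    · exact (Real.rpow_pos_of_pos (sq_add_four_mul_pos (hm q.1 q.2)).1 _).ne'
    · exact .inr (by norm_num)
    · exact (Real.rpow_pos_of_pos (sq_add_four_mul_pos (hm q.1 q.2)).2 _).ne'
  have hsymm : ∀ (r : P) t, Feps ρ (2 * Real.pi - t) r = Feps ρ t r := by
    intro r t
    have : ρ (2 * Real.pi - t) = ρ t := by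
      rw [hρ, hρ, kepler_reflect ⟨hε0, hε1⟩ hKepler, Real.cos_two_pi_sub]
    simp only [Feps, this, Real.cos_two_pi_sub]
  have hbC : ∀ (r : P) t, Feps ρ t r ≤ 1 / (1 - ε) := by
    intro r t
    refine (Feps_le (hm r t)).trans ?_
    have h1 := mul_le_mul (hr r).1 (hρ₁ t) hε3.le (by linarith [(hr r).1])
    gcongr
    linarith
  let κ : P → ℝ := fun r => √(1 / (108 * (2 - r.1 * (1 + ε)) ^ 3))
  have hκ : Continuous κ := by
    refine Real.continuous_sqrt.comp (.div continuous_const (by fun_prop) fun r => ?_)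
    have := (hgap r).1
    positivity
  have hκ₁ : ∀ r, 1 ≤ κ r := by
    intro r
    obtain ⟨h1, h2⟩ := hgap r
    refine Real.one_le_sqrt.2 ((one_le_div (by positivity)).2 ?_)
    calc 108 * (2 - r.1 * (1 + ε)) ^ 3 ≤ 108 * (1 / 5) ^ 3 := by gcongr
      _ ≤ 1 := by norm_num
  have hrot : ∀ N : ℝ, ∃ r : P, ∃ η ∈ Icc 0 Real.pi, N ≤ κ r * η ∧
      ∀ t ∈ Icc (Real.pi - η) Real.pi, Feps ρ t r ≤ -κ r ^ 2 := by
    intro N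
    have hpos : 0 < min (min (1 / 8) ((1 - ε) ^ 2))
        (min (2 - a' * (1 + ε)) (1 / (108 * (N ^ 2 + 1)))) := by
      rw [lt_div_iff₀ hε2] at ha'
      refine lt_min (lt_min (by norm_num) (by positivity)) (lt_min (by linarith) (by positivity))
    obtain ⟨δ, hδ, hδlt⟩ := exists_between hpos
    simp only [lt_min_iff] at hδlt
    obtain ⟨⟨hδ₁, hδ₂⟩, hδ₃, hδ₄⟩ := hδlt
    let r : P := ⟨(2 - δ) / (1 + ε), by
      rw [lt_div_iff₀ hε2]; linarith, by gcongr; linarith⟩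
    have hgr : 2 - r.1 * (1 + ε) = δ := by
      simp only [r]
      field_simp
      ring
    have hκr : κ r = √(1 / (108 * δ ^ 3)) := by simp only [κ, hgr]
    have hκsq : κ r ^ 2 = 1 / (108 * δ ^ 3) := by
      rw [hκr, Real.sq_sqrt (by positivity)]
    refine ⟨r, δ, ⟨hδ.le, by linarith [Real.pi_gt_three]⟩, ?_, ?_⟩
    · have h1 : N ^ 2 ≤ (κ r * δ) ^ 2 := by
        rw [mul_pow, hκsq]
        rw [lt_div_iff₀ (by positivity)] at hδ₄
        rw [div_mul_eq_mul_div, le_div_iff₀ (by positivity)]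
        nlinarith [pow_pos hδ 2]
      exact (le_abs_self N).trans
        (abs_le_of_sq_le_sq h1 (mul_nonneg (by linarith [hκ₁ r]) hδ.le))
    · intro t ht
      have htδ : |t - Real.pi| ≤ δ := abs_le.2 ⟨by linarith [ht.1], by linarith [ht.2]⟩
      have hcos : 1 + Real.cos (u t) ≤ δ / 2 := by
        have h1 := Real.one_sub_sq_div_two_le_cos (x := u t - Real.pi)
        rw [Real.cos_sub_pi] at h1
        have h2 := (kepler_abs_sub_pi_le ⟨hε0, hε1⟩ hKepler t).trans htδ
        have h3 : (1 - ε) ^ 2 * (u t - Real.pi) ^ 2 ≤ δ ^ 2 := by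
          rw [← sq_abs (u t - Real.pi), ← mul_pow]
          gcongr
        have h4 : (u t - Real.pi) ^ 2 ≤ δ := by
          have h5 : δ * (u t - Real.pi) ^ 2 ≤ (1 - ε) ^ 2 * (u t - Real.pi) ^ 2 := by gcongr
          nlinarith
        linarith
      have hmδ : 2 - 2 * δ ≤ r.1 * ρ t := by
        have h1 : r.1 * ρ t = 2 - δ - r.1 * ε * (1 + Real.cos (u t)) := by
          rw [hρ]
          linear_combination -hgr
        have h2 : 0 ≤ 1 + Real.cos (u t) := by linarith [Real.neg_one_le_cos (u t)]
        have h3 : r.1 * ε ≤ 2 := by nlinarith [(hr r).1, (hr r).2]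
        have h4 : r.1 * ε * (1 + Real.cos (u t)) ≤ 2 * (δ / 2) := by gcongr
        linarith
      refine (Feps_le_neg hδ hδ₁.le (hm r t).2 hmδ htδ).trans ?_
      have h1 := hκ₁ r
      have h2 : 1 / (54 * δ ^ 3) = 2 * κ r ^ 2 := by
        rw [hκsq]
        field_simp
        norm_num
      rw [h2]
      nlinarith
  obtain ⟨x₁, v₁, x₂, v₂, hfund, hcont, ⟨p, hp⟩, ⟨q, hq⟩⟩ :=
    exists_trace_eq_two_and_zero hb hsymm hκ hκ₁ (by positivity) hbC hrot
  have haP : ∀ r : P, a < r.1 := fun r => (le_max_left _ _).trans_lt r.2.1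
  refine ⟨?_, p.1, haP p, p.2.2, _, _, _, _, hfund p, by rw [hp]; norm_num⟩
  let S : Set P := {r | |x₁ r (2 * Real.pi) + v₂ r (2 * Real.pi)| < 2}
  have hopen : IsOpen (Set.image Subtype.val S) :=
    isOpen_Ioo.isOpenMap_subtype_val _ (isOpen_lt hcont.abs continuous_const)
  have hmem : q.1 ∈ Set.image Subtype.val S := ⟨q, by simp [S, hq], rfl⟩
  obtain ⟨h, hqh, hsub⟩ :=
    exists_Ico_subset_of_mem_nhds (hopen.mem_nhds hmem) ⟨q.1 + 1, lt_add_one q.1⟩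
  obtain ⟨h', hqh', hh'⟩ := exists_between hqh
  refine ⟨q.1, h', haP q, hqh', ?_, fun r hr₁ hr₂ y₁ w₁ y₂ w₂ hy => ?_⟩
  · obtain ⟨r, -, hr⟩ := hsub ⟨hqh'.le, hh'⟩
    exact hr ▸ r.2.2
  · obtain ⟨s, hs, rfl⟩ := hsub ⟨hr₁.le, hr₂.trans hh'⟩
    rw [(hfund s).trace_unique hy]
    exact hs

end Sitnikov

/-- Intervals and points that occur arbitrarily close to `L` from below can be arranged
alternately along a sequence converging to `L`. -/
lemma exists_interlacing_seq {L a₀ : ℝ} (ha₀ : a₀ < L) {G : ℝ → ℝ → Prop} {B : ℝ → Prop}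
    (hG : ∀ a < L, ∃ l h, a < l ∧ l < h ∧ h < L ∧ G l h)
    (hB : ∀ a < L, ∃ r, a < r ∧ r < L ∧ B r) :
    ∃ R : ℕ → ℝ, (∀ n, a₀ < R n ∧ R n < L) ∧
      (∀ n, R (2 * n) ≤ R (2 * n + 1) ∧ R (2 * n + 1) < R (2 * n + 2)) ∧
      Tendsto R atTop (𝓝 L) ∧ (∀ n, G (R (2 * n + 1)) (R (2 * n + 2))) ∧
      ∀ n, ∃ r, R (2 * n + 2) < r ∧ r < R (2 * n + 3) ∧ B r := by
  choose! l h hal hlh hhL hlhG using hG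
  choose! s has hsL hsB using hB
  let c : ℕ → ℝ := fun n => n.rec a₀ fun n c => max (s (h c)) (L - 1 / (n + 1))
  have hc_succ : ∀ n, c (n + 1) = max (s (h (c n))) (L - 1 / (n + 1)) := fun n => rfl
  have hcL : ∀ n, c n < L := by
    intro n
    induction n with
    | zero => exact ha₀
    | succ n ih =>
      rw [hc_succ]
      exact max_lt (hsL _ (hhL _ ih)) (sub_lt_self _ (by positivity))
  have hsc : ∀ n, s (h (c n)) ≤ c (n + 1) := fun n => le_max_left _ _
  have hhs : ∀ n, h (c n) < s (h (c n)) := fun n => has _ (hhL _ (hcL n))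
  have hcl : ∀ n, c n < l (c n) := fun n => hal _ (hcL n)
  have hclh : ∀ n, l (c n) < h (c n) := fun n => hlh _ (hcL n)
  have ha₀c : ∀ n, a₀ ≤ c n := by
    intro n
    induction n with
    | zero => exact le_rfl
    | succ n ih => linarith [hcl n, hclh n, hhs n, hsc n]
  have hclim : Tendsto c atTop (𝓝 L) := by
    rw [← tendsto_add_atTop_iff_nat 1]
    refine tendsto_of_tendsto_of_tendsto_of_le_of_le (g := fun n : ℕ => L - 1 / ((n : ℝ) + 1))
      ?_ tendsto_const_nhds (fun n => le_max_right _ _) (fun n => (hcL (n + 1)).le)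
    simpa using tendsto_const_nhds.sub (tendsto_one_div_add_atTop_nhds_zero_nat (𝕜 := ℝ))
  let R : ℕ → ℝ := fun k =>
    if k = 0 then l (c 0) else if k % 2 = 1 then l (c ((k - 1) / 2)) else h (c ((k - 1) / 2))
  have hR0 : R 0 = l (c 0) := rfl
  have hR1 : ∀ n, R (2 * n + 1) = l (c n) := by
    intro n
    have h1 : (2 * n + 1) % 2 = 1 := by omega
    have h2 : (2 * n + 1 - 1) / 2 = n := by omega
    simp only [R, h1, h2]
    simp
  have hR2 : ∀ n, R (2 * n + 2) = h (c n) := by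
    intro n
    have h1 : (2 * n + 2) % 2 = 0 := by omega
    have h2 : (2 * n + 2 - 1) / 2 = n := by omega
    simp only [R, h1, h2]
    simp
  have hRmem : ∀ k, c ((k - 1) / 2) < R k ∧ R k < L := by
    intro k
    have h1 := hcl ((k - 1) / 2)
    have h2 := hclh ((k - 1) / 2)
    have h3 := hhL _ (hcL ((k - 1) / 2))
    by_cases hk : k = 0
    · subst hk
      exact ⟨h1, h2.trans h3⟩
    · simp only [R, hk, if_false]
      split_ifs
      · exact ⟨h1, h2.trans h3⟩
      · exact ⟨h1.trans h2, h3⟩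
  refine ⟨R, fun k => ⟨(ha₀c _).trans_lt (hRmem k).1, (hRmem k).2⟩, fun n => ⟨?_, ?_⟩, ?_,
    fun n => ?_, fun n => ⟨s (h (c n)), ?_, ?_, hsB _ (hhL _ (hcL n))⟩⟩
  · rcases n with _ | n
    · exact le_of_eq (hR1 0).symm
    · rw [hR1, show 2 * (n + 1) = 2 * n + 2 by ring, hR2]
      linarith [hhs n, hsc n, hcl (n + 1)]
  · rw [hR1, hR2]
    exact hclh n
  · refine tendsto_of_tendsto_of_tendsto_of_le_of_le (g := fun k => c ((k - 1) / 2))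
      (hclim.comp ?_) tendsto_const_nhds (fun k => (hRmem k).1.le) (fun k => (hRmem k).2.le)
    exact (Nat.tendsto_div_const_atTop two_ne_zero).comp (tendsto_sub_atTop_nat 1)
  · rw [hR1, hR2]
    exact hlhG _ (hcL n)
  · rw [hR2]
    exact hhs n
  · rw [show 2 * n + 3 = 2 * (n + 1) + 1 by ring, hR1]
    exact (hsc n).trans_lt (hcl (n + 1))

end Auxiliary

/-- Theorem 4.3: stability interchanges for the equilibrium `(π,0)` of
the curved Sitnikov problem: there is a sequence `r₀ ≤ r₁ < r₂ ≤ r₃ < ⋯ → 2/(1+ε)`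
such that the equilibrium is strongly (linearly) stable for `r ∈ (r_{2n-1}, r_{2n})`
(`n ≥ 1`), while each interval `(r_{2n}, r_{2n+1})` contains a value of `r` for which
it is not strongly stable. -/
theorem curved_sitnikov_stability_interchanges (ε : ℝ) (hε : ε ∈ Set.Ico (0 : ℝ) 1)
    (u : ℝ → ℝ) (hu : Continuous u)
    (hKepler : ∀ t, u t - ε * Real.sin (u t) = t)
    (ρ : ℝ → ℝ) (hρ : ∀ t, ρ t = 1 - ε * Real.cos (u t)) :
    ∃ R : ℕ → ℝ,
      (∀ n, 0 < R n ∧ R n < 2 / (1 + ε)) ∧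
      (∀ n, R (2 * n) ≤ R (2 * n + 1) ∧ R (2 * n + 1) < R (2 * n + 2)) ∧
      Filter.Tendsto R Filter.atTop (nhds (2 / (1 + ε))) ∧
      (∀ n, ∀ r : ℝ, R (2 * n + 1) < r → r < R (2 * n + 2) →
        ∀ x₁ v₁ x₂ v₂ : ℝ → ℝ, IsFundSolOf (fun t => Feps ρ t r) x₁ v₁ x₂ v₂ →
          |x₁ (2 * Real.pi) + v₂ (2 * Real.pi)| < 2) ∧
      (∀ n, ∃ r : ℝ, R (2 * n + 2) < r ∧ r < R (2 * n + 3) ∧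
        ∃ x₁ v₁ x₂ v₂ : ℝ → ℝ, IsFundSolOf (fun t => Feps ρ t r) x₁ v₁ x₂ v₂ ∧
          2 ≤ |x₁ (2 * Real.pi) + v₂ (2 * Real.pi)|) := by
  have h0 : (0 : ℝ) < 2 / (1 + ε) := by
    have := hε.1
    positivity
  exact exists_interlacing_seq h0
    (fun a ha => (exists_stable_and_unstable hε hu hKepler hρ ha).1)
    (fun a ha => (exists_stable_and_unstable hε hu hKepler hρ ha).2)
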